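/- Let u: ℝ² → ℝ be Lipschitz with Lipschitz constant ‖u‖_Lip, let 0 < δ ≤ 1, and let 𝓡 be a finite collection of parallelograms with vertical edges and dyadic shadows such that for every R ∈ 𝓡: |E(R)| ≥ δ |R| and |I(R)|·‖u‖_Lip ≤ 1/30. Then there exist a subcollection 𝓖 ⊆ 𝓡 and an absolute constant C such that |⋃_{R∈𝓡} R| ≤ C Σ_{R∈𝓖} |R| and ∫_{ℝ²} ( Σ_{R∈𝓖} 1_R )² ≤ C δ^{−1} Σ_{R∈𝓖} |R|. -/

import Mathlib

open MeasureTheory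
open scoped ENNReal NNReal

noncomputable section

/-- A parallelogram with two vertical edges: shadow (projection to the horizontal axis)
the interval of length `len` centered at `xc`, slope `slope`, height `height`, and central
line passing through `(xc, yc)`. -/
structure Pgram where
  xc : ℝ
  len : ℝ
  height : ℝ
  slope : ℝ
  yc : ℝ
  len_pos : 0 < len
  height_pos : 0 < height

/-- The set of points of a parallelogram with vertical edges. -/
def Pgram.toSet (R : Pgram) : Set (ℝ × ℝ) :=
  {z | |z.1 - R.xc| ≤ R.len / 2 ∧ |z.2 - (R.yc + R.slope * (z.1 - R.xc))| ≤ R.height / 2}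

/-- The area `|R| = |I(R)| · H(R)` of a parallelogram with vertical edges. -/
def Pgram.area (R : Pgram) : ℝ := R.len * R.height

/-- The uncertainty interval `U(R)`: the interval of length `2 H(R)/|I(R)|` centered
at the slope. -/
def Pgram.U (R : Pgram) : Set ℝ :=
  Set.Icc (R.slope - R.height / R.len) (R.slope + R.height / R.len)

/-- `E(R) = {z ∈ R : u(z) ∈ U(R)}`. -/
def Pgram.E (u : ℝ × ℝ → ℝ) (R : Pgram) : Set (ℝ × ℝ) :=
  {z ∈ R.toSet | u z ∈ R.U}

/-- The shadow of `R` is a dyadic interval. -/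
def Pgram.dyadicShadow (R : Pgram) : Prop :=
  ∃ k m : ℤ, R.len = 2 ^ k ∧ R.xc = ((m : ℝ) + 1 / 2) * 2 ^ k

/-- One-dimensional Hardy–Littlewood inequality at level `1`. -/
theorem volume_le_five_mul_lintegral (f : ℝ → ℝ≥0∞) (A : Set ℝ)
    (hA : ∀ y ∈ A, ∃ r > 0, ENNReal.ofReal (2 * r) ≤ ∫⁻ t in Metric.closedBall y r, f t) :
    volume A ≤ 5 * ∫⁻ t, f t := by
  by_cases hf : ∫⁻ t, f t = ∞
  · simp [hf]
  choose! r hr hrf using hA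
  have hbd : ∀ y ∈ A, r y ≤ (∫⁻ t, f t).toReal := fun y hy => by
    have h := (hrf y hy).trans (setLIntegral_le_lintegral _ f)
    have := (ENNReal.ofReal_le_iff_le_toReal hf).1 h
    linarith [hr y hy]
  obtain ⟨s, hsA, hdisj, hcov⟩ :=
    Vitali.exists_disjoint_subfamily_covering_enlargement_closedBall A id r _ hbd 5 (by norm_num)
  simp only [id_eq] at hdisj hcov
  have hs : s.Countable := hdisj.countable_of_nonempty_interior fun y hy => by
    rw [interior_closedBall _ (hr y (hsA hy)).ne']
    exact ⟨y, Metric.mem_ball_self (hr y (hsA hy))⟩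
  have hsub : A ⊆ ⋃ y ∈ s, Metric.closedBall y (5 * r y) := fun y hy => by
    obtain ⟨b, hb, hyb⟩ := hcov y hy
    exact Set.mem_biUnion hb (hyb (Metric.mem_closedBall_self (hr y hy).le))
  calc volume A ≤ ∑' y : s, volume (Metric.closedBall (y : ℝ) (5 * r y)) :=
        (measure_mono hsub).trans (measure_biUnion_le _ hs _)
    _ ≤ ∑' y : s, 5 * ∫⁻ t in Metric.closedBall (y : ℝ) (r y), f t := by
        refine ENNReal.tsum_le_tsum fun y => ?_
        have h5 : (5 : ℝ≥0∞) = ENNReal.ofReal 5 := by simp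
        calc volume (Metric.closedBall (y : ℝ) (5 * r y)) = 5 * ENNReal.ofReal (2 * r y) := by
              rw [Real.volume_closedBall, h5, ← ENNReal.ofReal_mul (by norm_num)]
              ring_nf
          _ ≤ _ := by gcongr; exact hrf y (hsA y.2)
    _ = 5 * ∫⁻ t in ⋃ y ∈ s, Metric.closedBall y (r y), f t := by
        rw [ENNReal.tsum_mul_left,
          lintegral_biUnion hs (fun _ _ => Metric.isClosed_closedBall.measurableSet) hdisj]
    _ ≤ 5 * ∫⁻ t, f t := by gcongr; exact Measure.restrict_le_self

/-- The half-open dyadic interval `[m 2^k, (m + 1) 2^k)`. -/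
def dyadicIco (k m : ℤ) : Set ℝ := Set.Ico (m * (2 : ℝ) ^ k) ((m + 1) * (2 : ℝ) ^ k)

theorem measurableSet_dyadicIco (k m : ℤ) : MeasurableSet (dyadicIco k m) := measurableSet_Ico

theorem volume_dyadicIco (k m : ℤ) : volume (dyadicIco k m) = ENNReal.ofReal ((2 : ℝ) ^ k) := by
  rw [dyadicIco, Real.volume_Ico]; ring_nf

theorem dyadicIco_nonempty (k m : ℤ) : (dyadicIco k m).Nonempty :=
  Set.nonempty_Ico.2 (by have := zpow_pos (two_pos (α := ℝ)) k; nlinarith)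

theorem dyadicIco_subset {k' k m' m : ℤ} (hk : k' ≤ k)
    (h : (dyadicIco k' m' ∩ dyadicIco k m).Nonempty) : dyadicIco k' m' ⊆ dyadicIco k m := by
  obtain ⟨y, ⟨h1, h2⟩, h3, h4⟩ := h
  obtain ⟨n, rfl⟩ := Int.le.dest hk
  have hp := zpow_pos (two_pos (α := ℝ)) k'
  have he : (2 : ℝ) ^ (k' + n) = ((2 ^ n : ℤ) : ℝ) * 2 ^ k' := by
    rw [zpow_add₀ two_ne_zero, mul_comm]; simp
  rw [he, ← mul_assoc] at h3 h4
  have h5 : m' < (m + 1) * 2 ^ n := by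
    exact_mod_cast lt_of_mul_lt_mul_right (h1.trans_lt h4) hp.le
  have h6 : m * 2 ^ n < m' + 1 := by
    exact_mod_cast lt_of_mul_lt_mul_right (h3.trans_lt h2) hp.le
  refine Set.Ico_subset_Ico ?_ ?_ <;> rw [he, ← mul_assoc] <;>
    refine mul_le_mul_of_nonneg_right ?_ hp.le
  · exact_mod_cast Int.lt_add_one_iff.1 h6
  · exact_mod_cast h5

theorem dyadicIco_eq_union (k m : ℤ) :
    dyadicIco k m = dyadicIco (k - 1) (2 * m) ∪ dyadicIco (k - 1) (2 * m + 1) := by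
  have hp := zpow_pos (two_pos (α := ℝ)) (k - 1)
  have he : (2 : ℝ) ^ k = 2 * 2 ^ (k - 1) := by
    rw [← zpow_one_add₀ two_ne_zero]; ring_nf
  simp only [dyadicIco, he]
  push_cast
  rw [show (2 * (m : ℝ) + 1 + 1) * 2 ^ (k - 1) = (m + 1) * (2 * 2 ^ (k - 1)) by ring,
    show 2 * (m : ℝ) * 2 ^ (k - 1) = m * (2 * 2 ^ (k - 1)) by ring,
    Set.Ico_union_Ico_eq_Ico] <;> nlinarith

theorem disjoint_dyadicIco_children (k m : ℤ) :
    Disjoint (dyadicIco (k - 1) (2 * m)) (dyadicIco (k - 1) (2 * m + 1)) := by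
  rw [Set.disjoint_left]
  rintro x ⟨-, h1⟩ ⟨h2, -⟩
  push_cast at h1 h2
  linarith

theorem dyadicIco_subset_parent (k m : ℤ) : dyadicIco k m ⊆ dyadicIco (k + 1) (m / 2) := by
  rw [dyadicIco_eq_union (k + 1), add_sub_cancel_right]
  rcases Int.emod_two_eq_zero_or_one m with h | h
  · rw [show 2 * (m / 2) = m by omega]; exact Set.subset_union_left
  · rw [show 2 * (m / 2) + 1 = m by omega]; exact Set.subset_union_right

theorem le_of_dyadicIco_subset {k' k m' m : ℤ} (h : dyadicIco k' m' ⊆ dyadicIco k m) :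
    k' ≤ k := by
  have := measure_mono (μ := volume) h
  rw [volume_dyadicIco, volume_dyadicIco, ENNReal.ofReal_le_ofReal_iff (by positivity)] at this
  exact (zpow_le_zpow_iff_right₀ one_lt_two).1 this

theorem volume_dyadicIco_children (k m : ℤ) :
    volume (dyadicIco (k - 1) (2 * m)) + volume (dyadicIco (k - 1) (2 * m + 1)) =
      volume (dyadicIco k m) := by
  rw [dyadicIco_eq_union k, measure_union (disjoint_dyadicIco_children k m)
    (measurableSet_dyadicIco _ _)]

theorem volume_dyadicIco_succ (k m n : ℤ) :
    volume (dyadicIco (k + 1) m) = 2 * volume (dyadicIco k n) := by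
  rw [volume_dyadicIco, volume_dyadicIco, zpow_add_one₀ two_ne_zero, mul_comm,
    ENNReal.ofReal_mul two_pos.le]
  simp

open Classical in
/-- A packing bound for the `J i` carried by intervals containing a given dyadic interval extends,
up to a factor `2`, to all of the `J i`. -/
theorem sum_volume_inter_dyadicIco_le {ι : Type*} (S : Finset ι) (κ μ : ι → ℤ) (J : ι → Set ℝ)
    (hJ : ∀ i ∈ S, J i ⊆ dyadicIco (κ i) (μ i)) (C : ℝ≥0∞)
    (hC : ∀ k m, (∃ i ∈ S, dyadicIco (κ i) (μ i) ⊆ dyadicIco k m) →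
      ∑ i ∈ S with dyadicIco k m ⊆ dyadicIco (κ i) (μ i), volume (J i ∩ dyadicIco k m)
        ≤ C * volume (dyadicIco k m))
    (k m : ℤ) (hk : ∃ i ∈ S, dyadicIco (κ i) (μ i) ⊆ dyadicIco k m) :
    ∑ i ∈ S, volume (J i ∩ dyadicIco k m) ≤ 2 * C * volume (dyadicIco k m) := by
  have main : ∀ (n : ℕ) (k m : ℤ), (∀ i ∈ S, k ≤ κ i + n) →
      (∃ i ∈ S, dyadicIco (κ i) (μ i) ⊆ dyadicIco (k + 1) (m / 2)) →
      ∑ i ∈ S, volume (J i ∩ dyadicIco k m) ≤ 2 * C * volume (dyadicIco k m) := by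
    intro n
    induction n with
    | zero => ?_
    | succ n ih => ?_
    all_goals
      intro k m hn hpar
      by_cases h1 : ∃ i ∈ S, κ i < k ∧ dyadicIco (κ i) (μ i) ⊆ dyadicIco k m
    · obtain ⟨i, hi, hlt, -⟩ := h1
      have := hn i hi
      simp at this; omega
    rotate_left
    · obtain ⟨i, hi, hlt, hsub⟩ := h1
      have hch : ∀ m', m' / 2 = m → ∑ i ∈ S, volume (J i ∩ dyadicIco (k - 1) m')
          ≤ 2 * C * volume (dyadicIco (k - 1) m') := fun m' hm' =>
        ih (k - 1) m' (fun j hj => by have := hn j hj; push_cast at this; omega)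
          ⟨i, hi, by rw [sub_add_cancel, hm']; exact hsub⟩
      calc ∑ i ∈ S, volume (J i ∩ dyadicIco k m)
          ≤ ∑ i ∈ S, (volume (J i ∩ dyadicIco (k - 1) (2 * m)) +
              volume (J i ∩ dyadicIco (k - 1) (2 * m + 1))) := by
            gcongr with i hi
            rw [dyadicIco_eq_union k, Set.inter_union_distrib_left]
            exact measure_union_le _ _
        _ ≤ 2 * C * volume (dyadicIco (k - 1) (2 * m)) +
              2 * C * volume (dyadicIco (k - 1) (2 * m + 1)) := by
            rw [Finset.sum_add_distrib]
            exact add_le_add (hch _ (by omega)) (hch _ (by omega))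
        _ = 2 * C * volume (dyadicIco k m) := by
            rw [← mul_add, volume_dyadicIco_children]
    all_goals
      push Not at h1
      by_cases h2 : ∃ i ∈ S, dyadicIco (κ i) (μ i) ⊆ dyadicIco k m
      · calc ∑ i ∈ S, volume (J i ∩ dyadicIco k m)
            = ∑ i ∈ S with dyadicIco k m ⊆ dyadicIco (κ i) (μ i),
                volume (J i ∩ dyadicIco k m) := by
              rw [Finset.sum_filter_of_ne]
              intro i hi hne
              obtain ⟨x, hx⟩ := nonempty_of_measure_ne_zero hne
              have hx' := hJ i hi hx.1
              refine dyadicIco_subset ?_ ⟨x, hx.2, hx'⟩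
              by_contra! hlt
              exact h1 i hi hlt (dyadicIco_subset hlt.le ⟨x, hx', hx.2⟩)
          _ ≤ C * volume (dyadicIco k m) := hC k m h2
          _ ≤ 2 * C * volume (dyadicIco k m) := by
              gcongr; exact le_mul_of_one_le_left' one_le_two
      · calc ∑ i ∈ S, volume (J i ∩ dyadicIco k m)
            = ∑ i ∈ S with dyadicIco (k + 1) (m / 2) ⊆ dyadicIco (κ i) (μ i),
                volume (J i ∩ dyadicIco k m) := by
              rw [Finset.sum_filter_of_ne]
              intro i hi hne
              obtain ⟨x, hx⟩ := nonempty_of_measure_ne_zero hne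
              have hx' := hJ i hi hx.1
              refine dyadicIco_subset ?_ ⟨x, dyadicIco_subset_parent k m hx.2, hx'⟩
              by_contra! hlt
              exact h2 ⟨i, hi, dyadicIco_subset (by omega) ⟨x, hx', hx.2⟩⟩
          _ ≤ ∑ i ∈ S with dyadicIco (k + 1) (m / 2) ⊆ dyadicIco (κ i) (μ i),
                volume (J i ∩ dyadicIco (k + 1) (m / 2)) := by
              gcongr
              exact dyadicIco_subset_parent k m
          _ ≤ C * volume (dyadicIco (k + 1) (m / 2)) := hC _ _ hpar
          _ = 2 * C * volume (dyadicIco k m) := by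
              rw [volume_dyadicIco_succ k _ m]; ring
  obtain ⟨i, hi, hsub⟩ := hk
  obtain ⟨b, hb⟩ := (S.image κ).bddBelow
  refine main (k - b).toNat k m (fun j hj => ?_) ⟨i, hi, hsub.trans (dyadicIco_subset_parent k m)⟩
  have := hb (Finset.mem_coe.2 (Finset.mem_image_of_mem κ hj))
  omega

open Classical in
/-- If every interval of a finite dyadic family meets `A` in a fixed proportion and the sets `J i`
satisfy a Carleson packing condition, the total mass is controlled by the measure of `A`. -/
theorem sum_volume_le_of_packing {ι : Type*} (S : Finset ι) (κ μ : ι → ℤ) (J : ι → Set ℝ)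
    (hJ : ∀ i ∈ S, J i ⊆ dyadicIco (κ i) (μ i)) (D : ℝ≥0∞) (A : Set ℝ)
    (hD : ∀ i ∈ S, ∑ j ∈ S, volume (J j ∩ dyadicIco (κ i) (μ i))
        ≤ D * volume (A ∩ dyadicIco (κ i) (μ i)))
    (k m : ℤ) (hk : ∀ i ∈ S, dyadicIco (κ i) (μ i) ⊆ dyadicIco k m) :
    ∑ i ∈ S, volume (J i) ≤ D * volume (A ∩ dyadicIco k m) := by
  have main : ∀ (n : ℕ) (k m : ℤ), (∀ i ∈ S, k < κ i + n) →
      ∑ i ∈ S with dyadicIco (κ i) (μ i) ⊆ dyadicIco k m, volume (J i)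
        ≤ D * volume (A ∩ dyadicIco k m) := by
    intro n
    induction n with
    | zero =>
      intro k m hn
      rw [Finset.sum_eq_zero]
      · simp
      intro i hi
      rw [Finset.mem_filter] at hi
      have := hn i hi.1
      have := le_of_dyadicIco_subset hi.2
      simp at *; omega
    | succ n ih =>
      intro k m hn
      by_cases h : ∃ i ∈ S, dyadicIco (κ i) (μ i) = dyadicIco k m
      · obtain ⟨i, hi, he⟩ := h
        rw [← he]
        refine le_trans ?_ (hD i hi)
        rw [← Finset.sum_filter_add_sum_filter_not S
          (fun j => dyadicIco (κ j) (μ j) ⊆ dyadicIco (κ i) (μ i))]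
        refine le_add_right (Finset.sum_le_sum fun j hj => ?_)
        rw [Finset.mem_filter] at hj
        rw [Set.inter_eq_left.2 ((hJ j hj.1).trans hj.2)]
      · push Not at h
        have hA : volume (A ∩ dyadicIco k m) = volume (A ∩ dyadicIco (k - 1) (2 * m)) +
            volume (A ∩ dyadicIco (k - 1) (2 * m + 1)) := by
          rw [← measure_inter_add_sdiff (A ∩ dyadicIco k m)
            (measurableSet_dyadicIco (k - 1) (2 * m)), dyadicIco_eq_union k]
          congr 2
          · rw [Set.inter_assoc, Set.union_inter_cancel_left]
          · rw [Set.inter_sdiff_assoc, Set.union_sdiff_left,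
              (disjoint_dyadicIco_children k m).sdiff_eq_right]
        have hch := fun m' => ih (k - 1) m' (fun j hj => by
          have := hn j hj; push_cast at this; omega)
        rw [hA, mul_add]
        refine le_trans ?_ (add_le_add (hch _) (hch _))
        rw [← Finset.sum_union_inter]
        refine le_add_right (Finset.sum_le_sum_of_subset fun i hi => ?_)
        simp only [Finset.mem_union, Finset.mem_filter] at hi ⊢
        obtain ⟨hi, hsub⟩ := hi
        have hlt : κ i < k := by
          refine (le_of_dyadicIco_subset hsub).lt_of_ne fun he => h i hi ?_
          obtain ⟨x, hx⟩ := dyadicIco_nonempty (κ i) (μ i)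
          exact hsub.antisymm (dyadicIco_subset he.ge ⟨x, hsub hx, hx⟩)
        obtain ⟨x, hx⟩ := dyadicIco_nonempty (κ i) (μ i)
        have hxk := hsub hx
        rw [dyadicIco_eq_union k] at hxk
        exact hxk.imp (fun h' => ⟨hi, dyadicIco_subset (by omega) ⟨x, hx, h'⟩⟩)
          (fun h' => ⟨hi, dyadicIco_subset (by omega) ⟨x, hx, h'⟩⟩)
  obtain ⟨b, hb⟩ := (S.image κ).bddBelow
  have := main (k - b + 1).toNat k m (fun j hj => by
    have := hb (Finset.mem_coe.2 (Finset.mem_image_of_mem κ hj))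
    omega)
  rwa [Finset.filter_true_of_mem hk] at this

namespace Pgram

/-- The central line of `R`. -/
def line (R : Pgram) (x : ℝ) : ℝ := R.yc + R.slope * (x - R.xc)

theorem continuous_line (R : Pgram) : Continuous R.line := by unfold line; fun_prop

theorem mem_toSet {R : Pgram} {z : ℝ × ℝ} :
    z ∈ R.toSet ↔ |z.1 - R.xc| ≤ R.len / 2 ∧ |z.2 - R.line z.1| ≤ R.height / 2 := Iff.rfl

theorem line_sub_line (R R' : Pgram) (x y : ℝ) :
    R.line x - R'.line x = R.line y - R'.line y + (R.slope - R'.slope) * (x - y) := by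
  unfold line; ring

theorem isClosed_toSet (R : Pgram) : IsClosed R.toSet := by
  have := R.continuous_line
  exact (isClosed_le (f := fun z : ℝ × ℝ => |z.1 - R.xc|) (by fun_prop) continuous_const).inter
    (isClosed_le (f := fun z : ℝ × ℝ => |z.2 - R.line z.1|) (by fun_prop) continuous_const)

theorem measurableSet_toSet (R : Pgram) : MeasurableSet R.toSet :=
  R.isClosed_toSet.measurableSet

/-- The closed shadow of `R`. -/
def shadow (R : Pgram) : Set ℝ := Metric.closedBall R.xc (R.len / 2)

theorem mem_shadow {R : Pgram} {x : ℝ} : x ∈ R.shadow ↔ |x - R.xc| ≤ R.len / 2 := by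
  rw [shadow, Metric.mem_closedBall, Real.dist_eq]

theorem measurableSet_shadow (R : Pgram) : MeasurableSet R.shadow :=
  Metric.isClosed_closedBall.measurableSet

theorem area_pos (R : Pgram) : 0 < R.area := mul_pos R.len_pos R.height_pos

theorem volume_toSet_inter_fst_preimage (R : Pgram) {A : Set ℝ} (hA : MeasurableSet A) :
    volume (R.toSet ∩ Prod.fst ⁻¹' A) = ENNReal.ofReal R.height * volume (A ∩ R.shadow) := by
  rw [Measure.volume_eq_prod,
    Measure.prod_apply (R.measurableSet_toSet.inter (measurable_fst hA)),
    ← lintegral_indicator_const (hA.inter R.measurableSet_shadow)]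
  congr 1 with x
  by_cases hx : x ∈ A ∩ R.shadow
  · rw [Set.indicator_of_mem hx]
    have : Prod.mk x ⁻¹' (R.toSet ∩ Prod.fst ⁻¹' A) =
        Metric.closedBall (R.line x) (R.height / 2) := by
      ext y
      simp [mem_toSet, hx.1, mem_shadow.1 hx.2, Real.dist_eq]
    rw [this, Real.volume_closedBall]
    ring_nf
  · rw [Set.indicator_of_notMem hx]
    convert measure_empty (μ := (volume : Measure ℝ))
    rw [Set.eq_empty_iff_forall_notMem]
    rintro y ⟨hy, hyA⟩
    exact hx ⟨hyA, mem_shadow.2 hy.1⟩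

theorem volume_toSet (R : Pgram) : volume R.toSet = ENNReal.ofReal R.area := by
  have := R.volume_toSet_inter_fst_preimage MeasurableSet.univ
  rw [Set.preimage_univ, Set.inter_univ, Set.univ_inter, shadow, Real.volume_closedBall,
    ← ENNReal.ofReal_mul R.height_pos.le] at this
  rw [this, area]; ring_nf

open Classical in
/-- The contribution of a family of parallelograms to a vertical segment of length comparable to
`h` around `z`. -/
def load (S : Finset Pgram) (z : ℝ × ℝ) (h : ℝ) : ℝ :=
  ∑ R ∈ S with z.1 ∈ R.shadow ∧ |R.line z.1 - z.2| ≤ 10 * max R.height h, min R.height h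

theorem min_height_nonneg (R : Pgram) {h : ℝ} (hh : 0 < h) : 0 ≤ min R.height h :=
  le_min R.height_pos.le hh.le

theorem load_mono {S T : Finset Pgram} (hST : S ⊆ T) (z : ℝ × ℝ) {h : ℝ} (hh : 0 < h) :
    load S z h ≤ load T z h := by
  classical
  exact Finset.sum_le_sum_of_subset_of_nonneg (Finset.filter_subset_filter _ hST)
    fun R _ _ => R.min_height_nonneg hh

theorem sum_min_height_le_load {S T : Finset Pgram} (hST : S ⊆ T) {z : ℝ × ℝ} {h : ℝ}
    (hh : 0 < h) (hS : ∀ R ∈ S, z.1 ∈ R.shadow ∧ |R.line z.1 - z.2| ≤ 10 * max R.height h) :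
    ∑ R ∈ S, min R.height h ≤ load T z h := by
  classical
  refine le_trans (le_of_eq ?_) (load_mono hST z hh)
  rw [load, Finset.filter_true_of_mem hS]

/-- The number of `21`-fold vertical dilates of members of `S` that contain `(x, y)`. -/
def dilateSum (S : Finset Pgram) (x y : ℝ) : ℝ≥0∞ :=
  ∑ R ∈ S, R.shadow.indicator 1 x *
    (Metric.closedBall (R.line x) (21 / 2 * R.height)).indicator 1 y

theorem load_le_lintegral (S : Finset Pgram) (z : ℝ × ℝ) {h : ℝ} (hh : 0 < h) :
    ENNReal.ofReal (load S z h) ≤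
      ∫⁻ y in Metric.closedBall z.2 (21 / 2 * h), dilateSum S z.1 y := by
  classical
  unfold dilateSum
  rw [lintegral_finsetSum _ fun R _ => (measurable_one.indicator
      Metric.isClosed_closedBall.measurableSet).const_mul _,
    load, ENNReal.ofReal_sum_of_nonneg fun R _ => R.min_height_nonneg hh]
  refine (Finset.sum_le_sum fun R hR => ?_).trans
    (Finset.sum_le_sum_of_subset (Finset.filter_subset _ _))
  obtain ⟨-, hx, hd⟩ := Finset.mem_filter.1 hR
  simp only [Set.indicator_of_mem hx, Pi.one_apply, one_mul]
  rw [lintegral_indicator_one Metric.isClosed_closedBall.measurableSet,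
    Measure.restrict_apply Metric.isClosed_closedBall.measurableSet]
  have hH := R.height_pos
  rcases le_total R.height h with hle | hle
  · rw [min_eq_left hle]
    rw [max_eq_right hle] at hd
    calc ENNReal.ofReal R.height
        = volume (Metric.closedBall (R.line z.1) (R.height / 2)) := by
          rw [Real.volume_closedBall]; ring_nf
      _ ≤ _ := measure_mono (Set.subset_inter
          (Metric.closedBall_subset_closedBall (by linarith))
          (Metric.closedBall_subset_closedBall' (by rw [Real.dist_eq]; linarith)))
  · rw [min_eq_right hle]
    rw [max_eq_left hle, abs_sub_comm] at hd
    calc ENNReal.ofReal h = volume (Metric.closedBall z.2 (h / 2)) := by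
          rw [Real.volume_closedBall]; ring_nf
      _ ≤ _ := measure_mono (Set.subset_inter
          (Metric.closedBall_subset_closedBall' (by rw [Real.dist_eq]; linarith))
          (Metric.closedBall_subset_closedBall (by linarith)))

theorem lintegral_dilateSum (S : Finset Pgram) :
    ∫⁻ x, ∫⁻ y, dilateSum S x y = 21 * ENNReal.ofReal (∑ R ∈ S, R.area) := by
  have hin : ∀ x, ∫⁻ y, dilateSum S x y =
      ∑ R ∈ S, R.shadow.indicator (fun _ => ENNReal.ofReal (21 * R.height)) x := fun x => by
    unfold dilateSum
    rw [lintegral_finsetSum _ fun R _ => (measurable_one.indicator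
      Metric.isClosed_closedBall.measurableSet).const_mul _]
    refine Finset.sum_congr rfl fun R _ => ?_
    rw [lintegral_const_mul _ (measurable_one.indicator
        Metric.isClosed_closedBall.measurableSet),
      lintegral_indicator_one Metric.isClosed_closedBall.measurableSet, Real.volume_closedBall]
    by_cases hx : x ∈ R.shadow
    · rw [Set.indicator_of_mem hx, Set.indicator_of_mem hx, Pi.one_apply, one_mul]
      ring_nf
    · simp [hx]
  simp_rw [hin]
  rw [lintegral_finsetSum _ fun R _ => measurable_const.indicator R.measurableSet_shadow,
    ENNReal.ofReal_sum_of_nonneg fun R _ => R.area_pos.le, Finset.mul_sum]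
  refine Finset.sum_congr rfl fun R _ => ?_
  rw [lintegral_indicator_const R.measurableSet_shadow, shadow, Real.volume_closedBall,
    ← ENNReal.ofReal_mul (by linarith [R.height_pos]), area,
    show (21 : ℝ≥0∞) = ENNReal.ofReal 21 by simp, ← ENNReal.ofReal_mul (by norm_num)]
  ring_nf

/-- The region of high load is small, by the maximal inequality on vertical lines. -/
theorem volume_iUnion_le_of_load {S T : Finset Pgram}
    (h : ∀ R ∈ T, ∀ z ∈ R.toSet, ∃ h > 0, 21 * h < load S z h) :
    volume (⋃ R ∈ T, R.toSet) ≤ 105 * ENNReal.ofReal (∑ R ∈ S, R.area) := by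
  rw [Measure.volume_eq_prod, Measure.prod_apply
    (T.measurableSet_biUnion fun R _ => R.measurableSet_toSet)]
  calc ∫⁻ x, volume (Prod.mk x ⁻¹' ⋃ R ∈ T, R.toSet)
      ≤ ∫⁻ x, 5 * ∫⁻ y, dilateSum S x y := by
        refine lintegral_mono fun x => volume_le_five_mul_lintegral _ _ fun y hy => ?_
        simp only [Set.mem_preimage, Set.mem_iUnion, exists_prop] at hy
        obtain ⟨R, hR, hz⟩ := hy
        obtain ⟨r, hr, hlt⟩ := h R hR _ hz
        refine ⟨21 / 2 * r, by linarith, le_trans ?_ (load_le_lintegral S (x, y) hr)⟩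
        exact ENNReal.ofReal_le_ofReal (by linarith)
    _ = 105 * ENNReal.ofReal (∑ R ∈ S, R.area) := by
        rw [lintegral_const_mul' _ _ (by simp), lintegral_dilateSum, ← mul_assoc]
        norm_num

open Classical in
/-- Greedy selection in order of decreasing length. -/
theorem exists_greedy_selection (𝓡 : Finset Pgram) :
    ∃ 𝓖 ⊆ 𝓡, ∃ e : Pgram → ℕ, Set.InjOn e 𝓖 ∧
      (∀ R ∈ 𝓖, ∀ R' ∈ 𝓖, e R < e R' → R'.len ≤ R.len) ∧
      (∀ R ∈ 𝓖, ∃ z ∈ R.toSet, ∀ h > 0, load {R' ∈ 𝓖 | e R' < e R} z h ≤ 21 * h) ∧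
      ∀ R ∈ 𝓡 \ 𝓖, ∀ z ∈ R.toSet, ∃ h > 0, 21 * h < load 𝓖 z h := by
  induction 𝓡 using Finset.induction_on_min_value (fun R : Pgram => R.len) with
  | empty => exact ⟨∅, subset_rfl, fun _ => 0, by simp⟩
  | insert a s has hmin ih =>
    obtain ⟨𝓖, hsub, e, hinj, hlen, hgood, hbad⟩ := ih
    by_cases ha : ∀ z ∈ a.toSet, ∃ h > 0, 21 * h < load 𝓖 z h
    · refine ⟨𝓖, hsub.trans (Finset.subset_insert _ _), e, hinj, hlen, hgood, fun R hR => ?_⟩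
      rw [Finset.mem_sdiff, Finset.mem_insert] at hR
      obtain ⟨rfl | hR, hR'⟩ := hR
      · exact ha
      · exact hbad R (Finset.mem_sdiff.2 ⟨hR, hR'⟩)
    · push Not at ha
      have haG : a ∉ 𝓖 := fun h => has (hsub h)
      obtain ⟨N, hN⟩ := (𝓖.image e).bddAbove
      have hN : ∀ R ∈ 𝓖, e R < N + 1 := fun R hR =>
        Nat.lt_succ_of_le (hN (Finset.mem_coe.2 (Finset.mem_image_of_mem e hR)))
      set e' : Pgram → ℕ := Function.update e a (N + 1) with he'
      have hea : e' a = N + 1 := by simp [he']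
      have heG : ∀ R ∈ 𝓖, e' R = e R := fun R hR =>
        Function.update_of_ne (by rintro rfl; exact haG hR) _ _
      refine ⟨insert a 𝓖, Finset.insert_subset_insert _ hsub, e', ?_, ?_, ?_, ?_⟩
      · rw [Finset.coe_insert, Set.injOn_insert (by simpa using haG)]
        refine ⟨fun R hR R' hR' h => hinj hR hR' ?_, ?_⟩
        · rwa [heG R hR, heG R' hR'] at h
        · rintro ⟨R, hR, h⟩
          rw [hea, heG R hR] at h
          exact (hN R hR).ne h
      · intro R hR R' hR' hlt
        rw [Finset.mem_insert] at hR hR'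
        obtain rfl | hR' := hR'
        · obtain rfl | hR := hR
          · exact le_rfl
          · exact hmin R (hsub hR)
        · rw [heG R' hR'] at hlt
          obtain rfl | hR := hR
          · have := hN R' hR'; omega
          · exact hlen R hR R' hR' (by rwa [heG R hR] at hlt)
      · intro R hR
        rw [Finset.mem_insert] at hR
        obtain rfl | hR := hR
        · obtain ⟨z, hz, h⟩ := ha
          refine ⟨z, hz, fun r hr => (load_mono ?_ z hr).trans (h r hr)⟩
          intro R' hR'
          rw [Finset.mem_filter, Finset.mem_insert] at hR'
          obtain ⟨rfl | hR', hlt⟩ := hR'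
          · exact absurd hlt (lt_irrefl _)
          · exact hR'
        · obtain ⟨z, hz, h⟩ := hgood R hR
          refine ⟨z, hz, fun r hr => (load_mono ?_ z hr).trans (h r hr)⟩
          intro R' hR'
          rw [Finset.mem_filter, Finset.mem_insert] at hR'
          rw [Finset.mem_filter]
          obtain ⟨rfl | hR', hlt⟩ := hR'
          · have := hN R hR; rw [hea, heG R hR] at hlt; omega
          · exact ⟨hR', by rwa [heG R hR, heG R' hR'] at hlt⟩
      · intro R hR z hz
        simp only [Finset.mem_sdiff, Finset.mem_insert, not_or] at hR
        obtain ⟨h, hh, hlt⟩ := hbad R (Finset.mem_sdiff.2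
          ⟨hR.1.resolve_left hR.2.1, hR.2.2⟩) z hz
        exact ⟨h, hh, hlt.trans_le (load_mono (Finset.subset_insert _ _) z hh)⟩

theorem abs_line_sub_le (R : Pgram) (s b x y : ℝ) :
    |R.line x - (b + s * x)| ≤ |R.line y - (b + s * y)| + |R.slope - s| * |x - y| := by
  rw [← abs_mul]
  refine le_trans (le_of_eq ?_) (abs_add_le _ _)
  unfold line
  ring_nf

/-- The half-open shadow of `R`. -/
def ico (R : Pgram) : Set ℝ := Set.Ico (R.xc - R.len / 2) (R.xc + R.len / 2)

theorem closure_ico (R : Pgram) : closure R.ico = R.shadow := by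
  rw [ico, closure_Ico (by linarith [R.len_pos]), shadow, Real.closedBall_eq_Icc]

theorem volume_ico (R : Pgram) : volume R.ico = ENNReal.ofReal R.len := by
  rw [ico, Real.volume_Ico]; ring_nf

theorem volume_inter_shadow (R : Pgram) (A : Set ℝ) :
    volume (A ∩ R.shadow) = volume (A ∩ R.ico) := by
  rw [ico, shadow, Real.closedBall_eq_Icc]
  exact measure_congr ((ae_eq_refl A).inter Ico_ae_eq_Icc.symm)

theorem dyadicShadow.exists_ico_eq {R : Pgram} (h : R.dyadicShadow) :
    ∃ k m : ℤ, R.len = 2 ^ k ∧ R.ico = dyadicIco k m := by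
  obtain ⟨k, m, hl, hx⟩ := h
  refine ⟨k, m, hl, ?_⟩
  rw [ico, dyadicIco, hl, hx]
  ring_nf

theorem dyadicShadow.ico_subset {R R' : Pgram} (h : R.dyadicShadow) (h' : R'.dyadicShadow)
    (hlen : R'.len ≤ R.len) (hne : (R'.ico ∩ R.ico).Nonempty) : R'.ico ⊆ R.ico := by
  obtain ⟨k, m, hl, he⟩ := h.exists_ico_eq
  obtain ⟨k', m', hl', he'⟩ := h'.exists_ico_eq
  rw [he, he'] at hne ⊢
  rw [hl, hl'] at hlen
  exact dyadicIco_subset ((zpow_le_zpow_iff_right₀ one_lt_two).1 hlen) hne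

theorem volume_toSet_inter_le (R R' : Pgram) :
    volume (R.toSet ∩ R'.toSet) ≤ ENNReal.ofReal R.height * volume (R'.shadow ∩ R.shadow) := by
  rw [← volume_toSet_inter_fst_preimage R R'.measurableSet_shadow]
  exact measure_mono (Set.inter_subset_inter_right _ fun z hz => mem_shadow.2 hz.1)

theorem volume_toSet_inter_eq_zero {R R' : Pgram} (h : ¬ (R'.ico ∩ R.ico).Nonempty) :
    volume (R.toSet ∩ R'.toSet) = 0 := by
  refine le_antisymm ((volume_toSet_inter_le R R').trans (le_of_eq ?_)) zero_le
  rw [volume_inter_shadow, Set.inter_comm, volume_inter_shadow, Set.inter_comm,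
    Set.not_nonempty_iff_eq_empty.1 h, measure_empty, mul_zero]

theorem volume_toSet_inter_le_min (R R' : Pgram) :
    volume (R.toSet ∩ R'.toSet) ≤ ENNReal.ofReal (R'.len * min R.height R'.height) := by
  have hs : volume R'.shadow = ENNReal.ofReal R'.len := by
    rw [shadow, Real.volume_closedBall]; ring_nf
  rcases le_total R.height R'.height with h | h
  · rw [min_eq_left h, mul_comm, ENNReal.ofReal_mul R.height_pos.le, ← hs]
    exact (volume_toSet_inter_le R R').trans (by gcongr; exact Set.inter_subset_left)
  · rw [min_eq_right h]
    exact (measure_mono Set.inter_subset_right).trans R'.volume_toSet.le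

/-- Parallelograms over longer shadows whose slopes are comparable to that of `R'` overlap little
with `R'`, provided the load at some point of `R'` is small. -/
theorem sum_volume_inter_le_of_comparable (S : Finset Pgram) {R' : Pgram} {z : ℝ × ℝ}
    (hz : z ∈ R'.toSet) (hload : load S z R'.height ≤ 21 * R'.height)
    (hS : ∀ R ∈ S, R'.shadow ⊆ R.shadow ∧ R'.len ≤ R.len ∧
      |R.slope - R'.slope| ≤ 4 * (R.height / R.len + R'.height / R'.len)) :
    ∑ R ∈ S, volume (R.toSet ∩ R'.toSet) ≤ 21 * ENNReal.ofReal R'.area := by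
  classical
  set S' := {R ∈ S | (R.toSet ∩ R'.toSet).Nonempty} with hS'
  have hlp := R'.len_pos
  have hHp := R'.height_pos
  have hnear : ∀ R ∈ S', z.1 ∈ R.shadow ∧
      |R.line z.1 - z.2| ≤ 10 * max R.height R'.height := by
    intro R hR
    obtain ⟨hR, y, hyR, hyR'⟩ := Finset.mem_filter.1 hR
    obtain ⟨hsh, hlen, hslope⟩ := hS R hR
    refine ⟨hsh (mem_shadow.2 hz.1), ?_⟩
    have h1 : |z.1 - y.1| ≤ R'.len := by
      have := abs_sub_le z.1 R'.xc y.1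
      rw [abs_sub_comm R'.xc] at this
      linarith [hz.1, hyR'.1]
    have h2 : |R.slope - R'.slope| * |z.1 - y.1| ≤ 4 * (R.height + R'.height) :=
      calc |R.slope - R'.slope| * |z.1 - y.1|
          ≤ (4 * (R.height / R.len + R'.height / R'.len)) * R'.len :=
            mul_le_mul hslope h1 (abs_nonneg _) ((abs_nonneg _).trans hslope)
        _ = 4 * (R.height * (R'.len / R.len) + R'.height) := by field_simp
        _ ≤ 4 * (R.height * 1 + R'.height) := by
            have := R.height_pos
            gcongr
            exact (div_le_one R.len_pos).2 hlen
        _ = _ := by ring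
    have h3 : |R.line y.1 - R'.line y.1| ≤ R.height / 2 + R'.height / 2 := by
      have := abs_sub_le (R.line y.1) y.2 (R'.line y.1)
      rw [abs_sub_comm (R.line y.1) y.2] at this
      linarith [(mem_toSet.1 hyR).2, (mem_toSet.1 hyR').2]
    have h4 := line_sub_line R R' z.1 y.1
    have h5 := abs_add_le (R.line y.1 - R'.line y.1) ((R.slope - R'.slope) * (z.1 - y.1))
    rw [← h4, abs_mul] at h5
    have h6 := abs_sub_le (R.line z.1) (R'.line z.1) z.2
    rw [abs_sub_comm (R'.line z.1) z.2] at h6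
    linarith [(mem_toSet.1 hz).2, le_max_left R.height R'.height,
      le_max_right R.height R'.height]
  calc ∑ R ∈ S, volume (R.toSet ∩ R'.toSet) = ∑ R ∈ S', volume (R.toSet ∩ R'.toSet) :=
        (Finset.sum_filter_of_ne fun R _ h => nonempty_of_measure_ne_zero h).symm
    _ ≤ ∑ R ∈ S', ENNReal.ofReal (R'.len * min R.height R'.height) :=
        Finset.sum_le_sum fun R _ => volume_toSet_inter_le_min R R'
    _ = ENNReal.ofReal (R'.len * ∑ R ∈ S', min R.height R'.height) := by
        rw [Finset.mul_sum, ENNReal.ofReal_sum_of_nonneg]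
        exact fun R _ => mul_nonneg hlp.le (R.min_height_nonneg hHp)
    _ ≤ ENNReal.ofReal (R'.len * (21 * R'.height)) := by
        gcongr
        exact (sum_min_height_le_load (Finset.filter_subset _ _) hHp hnear).trans hload
    _ = 21 * ENNReal.ofReal R'.area := by
        rw [area, show (21 : ℝ≥0∞) = ENNReal.ofReal 21 by simp,
          ← ENNReal.ofReal_mul (by norm_num)]
        ring_nf

/-- The abscissae at which `R` meets the line `y = b + s x`. -/
def crossing (R : Pgram) (s b : ℝ) : Set ℝ :=
  {x | |R.line x - (b + s * x)| ≤ R.height / 2} ∩ R.ico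

theorem volume_crossing_le (R : Pgram) (s b : ℝ) {v : ℝ} (hv : 0 < v) (h : v ≤ |R.slope - s|) :
    volume (R.crossing s b) ≤ ENNReal.ofReal (R.height / v) := by
  refine (Real.volume_le_diam _).trans (Metric.ediam_le fun x hx y hy => ?_)
  rw [edist_dist, Real.dist_eq]
  refine ENNReal.ofReal_le_ofReal ((le_div_iff₀' hv).2 ?_)
  calc v * |x - y| ≤ |(R.slope - s) * (x - y)| := by rw [abs_mul]; gcongr
    _ = |(R.line x - (b + s * x)) - (R.line y - (b + s * y))| := by unfold line; ring_nf
    _ ≤ _ := (abs_sub _ _).trans (by linarith [hx.1.out, hy.1.out])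

/-- `R` is transversal to lines of slope `s`: its slope differs from `s` by at least four times its
uncertainty. -/
def Transversal (R : Pgram) (s : ℝ) : Prop := 4 * R.height ≤ |R.slope - s| * R.len

theorem Transversal.pos {R : Pgram} {s : ℝ} (h : R.Transversal s) : 0 < |R.slope - s| := by
  unfold Transversal at h
  exact pos_of_mul_pos_left (by linarith [R.height_pos]) R.len_pos.le

theorem Transversal.abs_sub_le {R : Pgram} {s b : ℝ} (h : R.Transversal s)
    (hc : (R.crossing s b).Nonempty) {z : ℝ × ℝ} (hz : z ∈ R.toSet) :
    |z.2 - (b + s * z.1)| ≤ 5 / 4 * (|R.slope - s| * R.len) := by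
  obtain ⟨x, hx, hx'⟩ := hc
  have hx' : |x - R.xc| ≤ R.len / 2 := by
    rw [← mem_shadow, ← closure_ico]; exact subset_closure hx'
  have h1 : |z.1 - x| ≤ R.len := by
    have := _root_.abs_sub_le z.1 R.xc x
    rw [abs_sub_comm R.xc] at this
    linarith [hz.1]
  have h2 := R.abs_line_sub_le s b z.1 x
  have h3 := mul_le_mul_of_nonneg_left h1 (abs_nonneg (R.slope - s))
  have h4 := _root_.abs_sub_le z.2 (R.line z.1) (b + s * z.1)
  unfold Transversal at h
  linarith [(mem_toSet.1 hz).2, hx.out]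

open Classical in
/-- Members of the selection whose slopes differ from `s` by about `2 ^ k` satisfy a packing
condition along the line `y = b + s x`. -/
theorem sum_volume_crossing_inter_le {𝓑 : Finset Pgram} {e : Pgram → ℕ} {s b : ℝ} {k : ℤ}
    (hdy : ∀ R ∈ 𝓑, R.dyadicShadow) (hinj : Set.InjOn e 𝓑)
    (hlen : ∀ R ∈ 𝓑, ∀ R' ∈ 𝓑, e R < e R' → R'.len ≤ R.len)
    (hgood : ∀ R ∈ 𝓑, ∃ z ∈ R.toSet, ∀ h > 0, load {R' ∈ 𝓑 | e R' < e R} z h ≤ 21 * h)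
    (htr : ∀ R ∈ 𝓑, R.Transversal s) (hcr : ∀ R ∈ 𝓑, (R.crossing s b).Nonempty)
    (hk : ∀ R ∈ 𝓑, (2 : ℝ) ^ k ≤ |R.slope - s| ∧ |R.slope - s| < 2 ^ (k + 1))
    (q n : ℤ) (hq : ∃ R ∈ 𝓑, R.ico ⊆ dyadicIco q n) :
    ∑ R ∈ 𝓑 with dyadicIco q n ⊆ R.ico, volume (R.crossing s b ∩ dyadicIco q n)
      ≤ 22 * volume (dyadicIco q n) := by
  obtain ⟨R', hR', hmax⟩ := Finset.exists_max_image {R ∈ 𝓑 | R.ico ⊆ dyadicIco q n} e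
    (by obtain ⟨R, hR⟩ := hq; exact ⟨R, Finset.mem_filter.2 hR⟩)
  obtain ⟨hR', hsub⟩ := Finset.mem_filter.1 hR'
  obtain ⟨z, hz, hload⟩ := hgood R' hR'
  have hqp : (0 : ℝ) < 2 ^ q := by positivity
  have hkp : (0 : ℝ) < 2 ^ k := by positivity
  have hlenR' : R'.len ≤ 2 ^ q := by
    have := measure_mono (μ := volume) hsub
    rwa [volume_ico, volume_dyadicIco, ENNReal.ofReal_le_ofReal_iff hqp.le] at this
  set T : ℝ := 2 ^ k * 2 ^ q with hT
  have hTp : 0 < T := by positivity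
  have hzq : z.1 ∈ Set.Icc (n * (2 : ℝ) ^ q) ((n + 1) * 2 ^ q) := by
    rw [← closure_Ico (by nlinarith)]
    refine closure_mono hsub ?_
    rw [closure_ico]
    exact mem_shadow.2 hz.1
  have hzl : |z.2 - (b + s * z.1)| ≤ 5 / 2 * T := by
    refine ((htr R' hR').abs_sub_le (hcr R' hR') hz).trans ?_
    calc 5 / 4 * (|R'.slope - s| * R'.len) ≤ 5 / 4 * (2 ^ (k + 1) * 2 ^ q) := by
          have := R'.len_pos.le
          gcongr
          exact (hk R' hR').2.le
      _ = 5 / 2 * T := by rw [zpow_add_one₀ two_ne_zero]; ring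
  set S := {R ∈ 𝓑 | dyadicIco q n ⊆ R.ico ∧ (R.crossing s b ∩ dyadicIco q n).Nonempty ∧ R ≠ R'}
    with hS
  have hSe : S ⊆ {R ∈ 𝓑 | e R < e R'} := by
    intro R hR
    obtain ⟨hR, hQ, -, hne⟩ := Finset.mem_filter.1 hR
    refine Finset.mem_filter.2 ⟨hR, ?_⟩
    by_contra! hle
    have hlt := hle.lt_of_ne fun h => hne (hinj hR hR' h.symm)
    have hRq := (hlen R' hR' R hR hlt).trans hlenR'
    obtain ⟨k', m', hl, he⟩ := (hdy R hR).exists_ico_eq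
    rw [hl] at hRq
    obtain ⟨x, hx⟩ := dyadicIco_nonempty q n
    refine hlt.not_ge (hmax R (Finset.mem_filter.2 ⟨hR, ?_⟩))
    rw [he] at hQ ⊢
    exact dyadicIco_subset ((zpow_le_zpow_iff_right₀ one_lt_two).1 hRq) ⟨x, hQ hx, hx⟩
  have hnear : ∀ R ∈ S, z.1 ∈ R.shadow ∧ |R.line z.1 - z.2| ≤ 10 * max R.height T := by
    intro R hR
    obtain ⟨hR, hQ, ⟨x, hx, hxq⟩, -⟩ := Finset.mem_filter.1 hR
    refine ⟨?_, ?_⟩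
    · rw [← closure_ico]
      refine closure_mono (hsub.trans hQ) ?_
      rw [closure_ico]
      exact mem_shadow.2 hz.1
    · have h1 : |z.1 - x| ≤ 2 ^ q := by
        rw [abs_le]
        constructor <;> linarith [hzq.1, hzq.2, hxq.1, hxq.2]
      have h2 := R.abs_line_sub_le s b z.1 x
      have h3 : |R.slope - s| * |z.1 - x| ≤ 2 * T := by
        calc |R.slope - s| * |z.1 - x| ≤ 2 ^ (k + 1) * 2 ^ q := by
              gcongr
              exact (hk R hR).2.le
          _ = 2 * T := by rw [zpow_add_one₀ two_ne_zero]; ring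
      have h4 := _root_.abs_sub_le (R.line z.1) (b + s * z.1) z.2
      rw [abs_sub_comm (b + s * z.1) z.2] at h4
      linarith [hx.1.out, le_max_left R.height T, le_max_right R.height T]
  have hvol : ∀ R ∈ S, volume (R.crossing s b ∩ dyadicIco q n) ≤
      ENNReal.ofReal (min R.height T / 2 ^ k) := by
    intro R hR
    have hR := (Finset.mem_filter.1 hR).1
    rcases le_total R.height T with h | h
    · rw [min_eq_left h]
      exact (measure_mono Set.inter_subset_left).trans
        (R.volume_crossing_le s b hkp (hk R hR).1)
    · rw [min_eq_right h, hT, mul_div_cancel_left₀ _ hkp.ne', ← volume_dyadicIco q n]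
      exact measure_mono Set.inter_subset_right
  calc ∑ R ∈ 𝓑 with dyadicIco q n ⊆ R.ico, volume (R.crossing s b ∩ dyadicIco q n)
      ≤ ∑ R ∈ insert R' S, volume (R.crossing s b ∩ dyadicIco q n) := by
        refine Finset.sum_le_sum_of_ne_zero fun R hR hne => ?_
        rw [Finset.mem_filter] at hR
        rw [Finset.mem_insert, hS, Finset.mem_filter]
        exact or_iff_not_imp_left.2 fun h => ⟨hR.1, hR.2, nonempty_of_measure_ne_zero hne, h⟩
    _ = volume (R'.crossing s b ∩ dyadicIco q n) +
          ∑ R ∈ S, volume (R.crossing s b ∩ dyadicIco q n) :=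
        Finset.sum_insert (by simp [hS])
    _ ≤ volume (dyadicIco q n) + ∑ R ∈ S, ENNReal.ofReal (min R.height T / 2 ^ k) :=
        add_le_add (measure_mono Set.inter_subset_right) (Finset.sum_le_sum hvol)
    _ = volume (dyadicIco q n) + ENNReal.ofReal ((∑ R ∈ S, min R.height T) / 2 ^ k) := by
        rw [Finset.sum_div, ENNReal.ofReal_sum_of_nonneg]
        exact fun R _ => div_nonneg (R.min_height_nonneg hTp) hkp.le
    _ ≤ volume (dyadicIco q n) + ENNReal.ofReal ((21 * T) / 2 ^ k) := by
        gcongr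
        exact (sum_min_height_le_load hSe hTp hnear).trans (hload T hTp)
    _ = 22 * volume (dyadicIco q n) := by
        rw [volume_dyadicIco, hT, show 21 * ((2 : ℝ) ^ k * 2 ^ q) / 2 ^ k = 21 * 2 ^ q by
          field_simp, ENNReal.ofReal_mul (by norm_num)]
        norm_num
        ring

/-- The abscissae at which `u`, along the line `y = b + s x`, differs from `s` by about `2 ^ k`. -/
def slopeGap (u : ℝ × ℝ → ℝ) (s b : ℝ) (k : ℤ) : Set ℝ :=
  {x | |u (x, b + s * x) - s| ∈ Set.Ico ((2 : ℝ) ^ (k - 1)) (2 ^ (k + 2))}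

theorem measurableSet_slopeGap {u : ℝ × ℝ → ℝ} (hu : Continuous u) (s b : ℝ) (k : ℤ) :
    MeasurableSet (slopeGap u s b k) :=
  measurableSet_Ico.preimage (f := fun x => |u (x, b + s * x) - s|) (by fun_prop)

theorem Transversal.fst_mem_slopeGap {u : ℝ × ℝ → ℝ} {Lu : ℝ≥0} (hu : LipschitzWith Lu u)
    {R : Pgram} {s b : ℝ} {k : ℤ} (h : R.Transversal s) (hc : (R.crossing s b).Nonempty)
    (hL : R.len * (Lu : ℝ) ≤ 1 / 30)
    (hk : (2 : ℝ) ^ k ≤ |R.slope - s| ∧ |R.slope - s| < 2 ^ (k + 1))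
    {z : ℝ × ℝ} (hz : z ∈ R.E u) : z.1 ∈ slopeGap u s b k := by
  obtain ⟨hzR, hzU⟩ := hz
  have h1 : |u z - R.slope| ≤ |R.slope - s| / 4 := by
    have h2 : R.height / R.len ≤ |R.slope - s| / 4 := by
      rw [div_le_iff₀ R.len_pos]
      unfold Transversal at h
      linarith
    rw [abs_le]
    constructor <;> linarith [hzU.1, hzU.2]
  have h2 : |u (z.1, b + s * z.1) - u z| ≤ |R.slope - s| / 24 := by
    have h3 := hu.dist_le_mul (z.1, b + s * z.1) z
    rw [Prod.dist_eq, dist_self, Real.dist_eq, Real.dist_eq, max_eq_right (abs_nonneg _),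
      abs_sub_comm (b + s * z.1)] at h3
    calc _ ≤ _ := h3
      _ ≤ Lu * (5 / 4 * (|R.slope - s| * R.len)) := by
          gcongr
          exact h.abs_sub_le hc hzR
      _ = 5 / 4 * |R.slope - s| * (R.len * Lu) := by ring
      _ ≤ 5 / 4 * |R.slope - s| * (1 / 30) := by gcongr
      _ = _ := by ring
  have h3 := _root_.abs_sub_le (u (z.1, b + s * z.1)) (u z) R.slope
  have h4 := _root_.abs_sub_le (u (z.1, b + s * z.1)) R.slope s
  have h5 := _root_.abs_sub_le R.slope (u (z.1, b + s * z.1)) s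
  rw [abs_sub_comm R.slope (u _)] at h5
  have e1 : (2 : ℝ) ^ (k - 1) = 2 ^ k / 2 := zpow_sub_one₀ two_ne_zero k
  have e2 : (2 : ℝ) ^ (k + 1) = 2 ^ k * 2 := zpow_add_one₀ two_ne_zero k
  have e3 : (2 : ℝ) ^ (k + 2) = 2 ^ k * 4 := by
    rw [zpow_add₀ two_ne_zero]; norm_num
  constructor <;> linarith [hk.1, hk.2]

theorem Transversal.volume_ico_le {u : ℝ × ℝ → ℝ} {Lu : ℝ≥0} (hu : LipschitzWith Lu u)
    {R : Pgram} {s b δ : ℝ} {k : ℤ} (h : R.Transversal s) (hc : (R.crossing s b).Nonempty)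
    (hL : R.len * (Lu : ℝ) ≤ 1 / 30) (hδ : 0 < δ)
    (hE : ENNReal.ofReal (δ * R.area) ≤ volume (R.E u))
    (hk : (2 : ℝ) ^ k ≤ |R.slope - s| ∧ |R.slope - s| < 2 ^ (k + 1)) :
    volume R.ico ≤ ENNReal.ofReal δ⁻¹ * volume (slopeGap u s b k ∩ R.ico) := by
  have h1 : volume (R.E u) ≤
      ENNReal.ofReal R.height * volume (slopeGap u s b k ∩ R.ico) := by
    rw [← volume_inter_shadow, ← R.volume_toSet_inter_fst_preimage
      (measurableSet_slopeGap hu.continuous s b k)]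
    exact measure_mono fun z hz => ⟨hz.1, h.fst_mem_slopeGap hu hc hL hk hz⟩
  have hH := R.height_pos
  calc volume R.ico = ENNReal.ofReal (δ⁻¹ * R.height⁻¹) * ENNReal.ofReal (δ * R.area) := by
        rw [volume_ico, ← ENNReal.ofReal_mul (by positivity), area]
        congr 1
        field_simp
    _ ≤ ENNReal.ofReal (δ⁻¹ * R.height⁻¹) *
          (ENNReal.ofReal R.height * volume (slopeGap u s b k ∩ R.ico)) := by
        gcongr
        exact hE.trans h1
    _ = _ := by
        rw [← mul_assoc, ← ENNReal.ofReal_mul (by positivity), mul_assoc,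
          inv_mul_cancel₀ hH.ne', mul_one]

/-- The sets `slopeGap u s b k`, `k : ℤ`, have overlap at most `3`. -/
theorem sum_volume_slopeGap_inter_le {u : ℝ × ℝ → ℝ} (hu : Continuous u) (s b : ℝ) (T : Finset ℤ)
    {Q : Set ℝ} (hQ : MeasurableSet Q) :
    ∑ k ∈ T, volume (slopeGap u s b k ∩ Q) ≤ 3 * volume Q := by
  set w : ℝ → ℝ := fun x => |u (x, b + s * x) - s| with hw
  have hwm : Measurable w := by
    have : Continuous w := by fun_prop
    exact this.measurable
  set B : ℤ → Set ℝ := fun n => w ⁻¹' Set.Ico ((2 : ℝ) ^ n) (2 ^ (n + 1)) with hB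
  have hBm : ∀ n, MeasurableSet (B n) := fun n => hwm measurableSet_Ico
  have hdisj : Pairwise (Function.onFun Disjoint B) := by
    intro m n hmn
    rw [Function.onFun, Set.disjoint_left]
    rintro x ⟨h1, h2⟩ ⟨h3, h4⟩
    have h5 := (zpow_lt_zpow_iff_right₀ one_lt_two).1 (h1.trans_lt h4)
    have h6 := (zpow_lt_zpow_iff_right₀ one_lt_two).1 (h3.trans_lt h2)
    omega
  have hcov : ∀ k, slopeGap u s b k ⊆ B (k - 1) ∪ B k ∪ B (k + 1) := by
    intro k x hx
    have hx : w x ∈ Set.Ico ((2 : ℝ) ^ (k - 1)) (2 ^ (k + 2)) := hx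
    by_cases h1 : w x < 2 ^ k
    · exact Or.inl (Or.inl ⟨hx.1, by rwa [sub_add_cancel]⟩)
    by_cases h2 : w x < 2 ^ (k + 1)
    · exact Or.inl (Or.inr ⟨not_lt.1 h1, h2⟩)
    · exact Or.inr ⟨not_lt.1 h2, by rw [add_assoc]; exact hx.2⟩
  have hshift : ∀ j : ℤ, ∑ k ∈ T, volume (B (k + j) ∩ Q) ≤ volume Q := by
    intro j
    rw [← measure_biUnion_finset]
    · exact measure_mono (Set.iUnion₂_subset fun _ _ => Set.inter_subset_right)
    · intro m _ n _ hmn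
      exact (hdisj (fun h => hmn (add_right_cancel h))).mono Set.inter_subset_left
        Set.inter_subset_left
    · exact fun n _ => (hBm _).inter hQ
  calc ∑ k ∈ T, volume (slopeGap u s b k ∩ Q)
      ≤ ∑ k ∈ T, (volume (B (k + -1) ∩ Q) + volume (B (k + 0) ∩ Q) +
          volume (B (k + 1) ∩ Q)) := by
        gcongr with k
        refine (measure_mono (Set.inter_subset_inter_left Q (hcov k))).trans ?_
        rw [Set.union_inter_distrib_right, Set.union_inter_distrib_right, add_zero]
        exact (measure_union_le _ _).trans (by gcongr; exact measure_union_le _ _)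
    _ ≤ volume Q + volume Q + volume Q := by
        rw [Finset.sum_add_distrib, Finset.sum_add_distrib]
        exact add_le_add (add_le_add (hshift _) (hshift _)) (hshift _)
    _ = 3 * volume Q := by ring

open Classical in
/-- Along a line of slope `s`, the total length of the crossings with transversal members of the
selection is controlled by the length of an interval containing their shadows. -/
theorem sum_volume_crossing_le {u : ℝ × ℝ → ℝ} {Lu : ℝ≥0} (hu : LipschitzWith Lu u)
    {δ : ℝ} (hδ : 0 < δ) {𝓑 : Finset Pgram} {e : Pgram → ℕ} (s b : ℝ)
    (hdy : ∀ R ∈ 𝓑, R.dyadicShadow) (hinj : Set.InjOn e 𝓑)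
    (hE : ∀ R ∈ 𝓑, ENNReal.ofReal (δ * R.area) ≤ volume (R.E u))
    (hL : ∀ R ∈ 𝓑, R.len * (Lu : ℝ) ≤ 1 / 30)
    (hlen : ∀ R ∈ 𝓑, ∀ R' ∈ 𝓑, e R < e R' → R'.len ≤ R.len)
    (hgood : ∀ R ∈ 𝓑, ∃ z ∈ R.toSet, ∀ h > 0, load {R' ∈ 𝓑 | e R' < e R} z h ≤ 21 * h)
    (htr : ∀ R ∈ 𝓑, R.Transversal s) (q n : ℤ) (hq : ∀ R ∈ 𝓑, R.ico ⊆ dyadicIco q n) :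
    ∑ R ∈ 𝓑, volume (R.crossing s b) ≤
      132 * ENNReal.ofReal δ⁻¹ * volume (dyadicIco q n) := by
  have hdy' : ∀ R ∈ 𝓑, ∃ k m : ℤ, R.ico = dyadicIco k m := fun R hR => by
    obtain ⟨k, m, -, he⟩ := (hdy R hR).exists_ico_eq
    exact ⟨k, m, he⟩
  choose! κ μ hκ using hdy'
  set f : Pgram → ℤ := fun R => Int.log 2 |R.slope - s| with hf
  set 𝓒 := {R ∈ 𝓑 | (R.crossing s b).Nonempty} with h𝓒
  have htype : ∀ k ∈ 𝓒.image f, ∑ R ∈ 𝓒 with f R = k, volume (R.crossing s b) ≤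
      44 * ENNReal.ofReal δ⁻¹ * volume (slopeGap u s b k ∩ dyadicIco q n) := by
    intro k _
    set 𝓓 := {R ∈ 𝓒 | f R = k} with h𝓓
    have hsub : 𝓓 ⊆ 𝓑 := (Finset.filter_subset _ _).trans (Finset.filter_subset _ _)
    have hcr : ∀ R ∈ 𝓓, (R.crossing s b).Nonempty := fun R hR =>
      (Finset.mem_filter.1 (Finset.mem_filter.1 hR).1).2
    have hk : ∀ R ∈ 𝓓, (2 : ℝ) ^ k ≤ |R.slope - s| ∧ |R.slope - s| < 2 ^ (k + 1) := by
      intro R hR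
      rw [← (Finset.mem_filter.1 hR).2]
      exact ⟨Int.zpow_log_le_self one_lt_two (htr R (hsub hR)).pos,
        Int.lt_zpow_succ_log_self one_lt_two _⟩
    have hpack := sum_volume_crossing_inter_le (b := b) (fun R hR => hdy R (hsub hR))
      (hinj.mono (Finset.coe_subset.2 hsub))
      (fun R hR R' hR' => hlen R (hsub hR) R' (hsub hR'))
      (fun R hR => by
        obtain ⟨z, hz, h⟩ := hgood R (hsub hR)
        exact ⟨z, hz, fun r hr =>
          (load_mono (Finset.filter_subset_filter _ hsub) z hr).trans (h r hr)⟩)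
      (fun R hR => htr R (hsub hR)) hcr hk
    have hJ : ∀ R ∈ 𝓓, R.crossing s b ⊆ dyadicIco (κ R) (μ R) := fun R hR => by
      rw [← hκ R (hsub hR)]
      exact Set.inter_subset_right
    refine sum_volume_le_of_packing 𝓓 κ μ _ hJ _ _ (fun R hR => ?_) q n
      (fun R hR => by rw [← hκ R (hsub hR)]; exact hq R (hsub hR))
    refine (sum_volume_inter_dyadicIco_le 𝓓 κ μ _ hJ 22 (fun q n hqn => ?_) _ _
      ⟨R, hR, subset_rfl⟩).trans ?_
    · obtain ⟨R₀, hR₀, h₀⟩ := hqn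
      refine le_trans (le_of_eq ?_)
        (hpack q n ⟨R₀, hR₀, by rwa [hκ R₀ (hsub hR₀)]⟩)
      refine Finset.sum_congr (Finset.filter_congr fun R hR => ?_) fun _ _ => rfl
      rw [hκ R (hsub hR)]
    · rw [← hκ R (hsub hR), mul_assoc 44]
      refine le_trans (le_of_eq ?_) (mul_le_mul_right ((htr R (hsub hR)).volume_ico_le hu
        (hcr R hR) (hL R (hsub hR)) hδ (hE R (hsub hR)) (hk R hR)) 44)
      norm_num
  calc ∑ R ∈ 𝓑, volume (R.crossing s b) = ∑ R ∈ 𝓒, volume (R.crossing s b) :=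
        (Finset.sum_filter_of_ne fun R _ h => nonempty_of_measure_ne_zero h).symm
    _ = ∑ k ∈ 𝓒.image f, ∑ R ∈ 𝓒 with f R = k, volume (R.crossing s b) :=
        (Finset.sum_fiberwise_of_maps_to (fun R hR => Finset.mem_image_of_mem f hR) _).symm
    _ ≤ ∑ k ∈ 𝓒.image f, 44 * ENNReal.ofReal δ⁻¹ *
          volume (slopeGap u s b k ∩ dyadicIco q n) := Finset.sum_le_sum htype
    _ ≤ 44 * ENNReal.ofReal δ⁻¹ * (3 * volume (dyadicIco q n)) := by
        rw [← Finset.mul_sum]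
        gcongr
        exact sum_volume_slopeGap_inter_le hu.continuous s b _ (measurableSet_dyadicIco q n)
    _ = _ := by ring

/-- Fubini after the shear `(x, t) ↦ (x, ℓ x + t)`. -/
theorem volume_eq_lintegral_shear {S : Set (ℝ × ℝ)} (hS : MeasurableSet S) {ℓ : ℝ → ℝ}
    (hℓ : Measurable ℓ) : volume S = ∫⁻ t, volume {x | (x, ℓ x + t) ∈ S} := by
  have hm : MeasurableSet {p : ℝ × ℝ | (p.1, ℓ p.1 + p.2) ∈ S} := by
    have : Measurable fun p : ℝ × ℝ => (p.1, ℓ p.1 + p.2) := by fun_prop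
    exact this hS
  rw [Measure.volume_eq_prod, Measure.prod_apply hS]
  refine Eq.trans ?_ (Measure.prod_apply_symm (μ := volume) (ν := volume) hm)
  rw [Measure.prod_apply hm]
  refine lintegral_congr fun x => ?_
  exact (measure_preimage_add volume (ℓ x) (Prod.mk x ⁻¹' S)).symm

theorem volume_toSet_inter_le_lintegral (R R' : Pgram) :
    volume (R.toSet ∩ R'.toSet) ≤ ∫⁻ t in Metric.closedBall 0 (R.height / 2),
      volume (R'.crossing R.slope (R.yc - R.slope * R.xc + t)) := by
  rw [volume_eq_lintegral_shear (R.measurableSet_toSet.inter R'.measurableSet_toSet)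
    R.continuous_line.measurable, ← lintegral_indicator Metric.isClosed_closedBall.measurableSet]
  refine lintegral_mono fun t => ?_
  by_cases ht : t ∈ Metric.closedBall (0 : ℝ) (R.height / 2)
  · rw [Set.indicator_of_mem ht, crossing, ← volume_inter_shadow]
    refine measure_mono fun x hx => ⟨?_, mem_shadow.2 hx.2.1⟩
    have h := (mem_toSet.1 hx.2).2
    rw [abs_sub_comm] at h
    have e : R.line x + t = R.yc - R.slope * R.xc + t + R.slope * x := by unfold line; ring
    rwa [Set.mem_ofPred_eq, ← e]
  · rw [Set.indicator_of_notMem ht]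
    refine (measure_mono_null (fun x hx => ht ?_) (measure_empty (μ := volume))).le
    rw [mem_closedBall_zero_iff, Real.norm_eq_abs]
    simpa using (mem_toSet.1 hx.1).2

open Classical in
/-- Transversal parallelograms over shorter shadows have controlled total overlap with `R`. -/
theorem sum_volume_inter_le_of_transversal {u : ℝ × ℝ → ℝ} {Lu : ℝ≥0} (hu : LipschitzWith Lu u)
    {δ : ℝ} (hδ : 0 < δ) {𝓑 : Finset Pgram} {e : Pgram → ℕ} {R : Pgram} (hR : R.dyadicShadow)
    (hdy : ∀ R' ∈ 𝓑, R'.dyadicShadow) (hinj : Set.InjOn e 𝓑)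
    (hE : ∀ R' ∈ 𝓑, ENNReal.ofReal (δ * R'.area) ≤ volume (R'.E u))
    (hL : ∀ R' ∈ 𝓑, R'.len * (Lu : ℝ) ≤ 1 / 30)
    (hlen : ∀ R₁ ∈ 𝓑, ∀ R₂ ∈ 𝓑, e R₁ < e R₂ → R₂.len ≤ R₁.len)
    (hgood : ∀ R' ∈ 𝓑, ∃ z ∈ R'.toSet, ∀ h > 0, load {R'' ∈ 𝓑 | e R'' < e R'} z h ≤ 21 * h)
    (htr : ∀ R' ∈ 𝓑, R'.Transversal R.slope) (hsub : ∀ R' ∈ 𝓑, R'.ico ⊆ R.ico) :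
    ∑ R' ∈ 𝓑, volume (R.toSet ∩ R'.toSet) ≤
      132 * ENNReal.ofReal δ⁻¹ * ENNReal.ofReal R.area := by
  obtain ⟨q, n, -, hq⟩ := hR.exists_ico_eq
  set I := Metric.closedBall (0 : ℝ) (R.height / 2)
  set f : Pgram → ℝ → ℝ≥0∞ := fun R' t =>
    volume (R'.crossing R.slope (R.yc - R.slope * R.xc + t))
  have hsuper : ∀ S : Finset Pgram, ∑ R' ∈ S, ∫⁻ t in I, f R' t ≤
      ∫⁻ t in I, ∑ R' ∈ S, f R' t := by
    intro S
    induction S using Finset.induction_on with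
    | empty => simp
    | insert R' S hR' ih =>
      simp_rw [Finset.sum_insert hR']
      exact (add_le_add_right ih _).trans (le_lintegral_add _ _)
  calc ∑ R' ∈ 𝓑, volume (R.toSet ∩ R'.toSet)
      ≤ ∫⁻ t in I, ∑ R' ∈ 𝓑, f R' t :=
        (Finset.sum_le_sum fun R' _ => volume_toSet_inter_le_lintegral R R').trans (hsuper 𝓑)
    _ ≤ ∫⁻ _ in I, 132 * ENNReal.ofReal δ⁻¹ * ENNReal.ofReal R.len := by
        refine lintegral_mono fun t => ?_
        rw [← volume_ico, hq]
        exact sum_volume_crossing_le hu hδ _ _ hdy hinj hE hL hlen hgood htr q n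
          fun R' hR' => hq ▸ hsub R' hR'
    _ = _ := by
        rw [setLIntegral_const, Real.volume_closedBall, mul_assoc (_ * _),
          ← ENNReal.ofReal_mul R.len_pos.le, area]
        ring_nf

open Classical in
/-- Every ordered pair is either comparable, and charged to the later parallelogram, or
transversal, and charged to the earlier one. -/
theorem sum_volume_inter_of_lt_le {u : ℝ × ℝ → ℝ} {Lu : ℝ≥0} (hu : LipschitzWith Lu u)
    {δ : ℝ} (hδ : 0 < δ) {𝓖 : Finset Pgram} {e : Pgram → ℕ}
    (hdy : ∀ R ∈ 𝓖, R.dyadicShadow) (hinj : Set.InjOn e 𝓖)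
    (hE : ∀ R ∈ 𝓖, ENNReal.ofReal (δ * R.area) ≤ volume (R.E u))
    (hL : ∀ R ∈ 𝓖, R.len * (Lu : ℝ) ≤ 1 / 30)
    (hlen : ∀ R ∈ 𝓖, ∀ R' ∈ 𝓖, e R < e R' → R'.len ≤ R.len)
    (hgood : ∀ R ∈ 𝓖, ∃ z ∈ R.toSet, ∀ h > 0, load {R' ∈ 𝓖 | e R' < e R} z h ≤ 21 * h) :
    ∑ R ∈ 𝓖, ∑ R' ∈ 𝓖 with e R < e R', volume (R.toSet ∩ R'.toSet) ≤
      (21 + 132 * ENNReal.ofReal δ⁻¹) * ∑ R ∈ 𝓖, ENNReal.ofReal R.area := by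
  let P : Pgram → Pgram → Prop := fun R R' => e R < e R' ∧ R'.ico ⊆ R.ico ∧
    |R.slope - R'.slope| ≤ 4 * (R.height / R.len + R'.height / R'.len)
  let Q : Pgram → Pgram → Prop := fun R R' => e R < e R' ∧ R'.ico ⊆ R.ico ∧
    R'.Transversal R.slope
  have hsplit : ∀ R ∈ 𝓖, ∑ R' ∈ 𝓖 with e R < e R', volume (R.toSet ∩ R'.toSet) ≤
      ∑ R' ∈ 𝓖 with P R R', volume (R.toSet ∩ R'.toSet) +
        ∑ R' ∈ 𝓖 with Q R R', volume (R.toSet ∩ R'.toSet) := by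
    intro R hR
    simp_rw [Finset.sum_filter]
    rw [← Finset.sum_add_distrib]
    refine Finset.sum_le_sum fun R' hR' => ?_
    by_cases hlt : e R < e R'
    swap
    · rw [if_neg hlt]; exact zero_le
    rw [if_pos hlt]
    by_cases hne : (R'.ico ∩ R.ico).Nonempty
    swap
    · rw [volume_toSet_inter_eq_zero hne]; exact zero_le
    have hsub := (hdy R hR).ico_subset (hdy R' hR') (hlen R hR R' hR' hlt) hne
    by_cases hc : |R.slope - R'.slope| ≤ 4 * (R.height / R.len + R'.height / R'.len)
    · rw [if_pos (show P R R' from ⟨hlt, hsub, hc⟩)]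
      exact le_self_add
    · refine le_add_left (le_of_eq (if_pos (show Q R R' from ⟨hlt, hsub, ?_⟩)).symm)
      have h1 : 4 * (R'.height / R'.len) ≤ |R'.slope - R.slope| := by
        rw [abs_sub_comm]
        have := div_pos R.height_pos R.len_pos
        linarith
      rw [Transversal, ← div_le_iff₀ R'.len_pos]
      rwa [mul_div_assoc]
  have hcomp : ∀ R' ∈ 𝓖, ∑ R ∈ 𝓖 with P R R', volume (R.toSet ∩ R'.toSet) ≤
      21 * ENNReal.ofReal R'.area := by
    intro R' hR'
    obtain ⟨z, hz, hload⟩ := hgood R' hR'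
    refine sum_volume_inter_le_of_comparable _ hz
      ((load_mono (fun R hR => ?_) z R'.height_pos).trans (hload _ R'.height_pos)) fun R hR => ?_
    · obtain ⟨hR, hP⟩ := Finset.mem_filter.1 hR
      exact Finset.mem_filter.2 ⟨hR, hP.1⟩
    · obtain ⟨hR, hlt, hsub, hs⟩ := Finset.mem_filter.1 hR
      refine ⟨?_, hlen R hR R' hR' hlt, hs⟩
      rw [← closure_ico, ← closure_ico]
      exact closure_mono hsub
  have htrans : ∀ R ∈ 𝓖, ∑ R' ∈ 𝓖 with Q R R', volume (R.toSet ∩ R'.toSet) ≤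
      132 * ENNReal.ofReal δ⁻¹ * ENNReal.ofReal R.area := by
    intro R hR
    have hsub : {R' ∈ 𝓖 | Q R R'} ⊆ 𝓖 := Finset.filter_subset _ _
    refine sum_volume_inter_le_of_transversal hu hδ (hdy R hR) (fun R' h => hdy R' (hsub h))
      (hinj.mono (Finset.coe_subset.2 hsub)) (fun R' h => hE R' (hsub h))
      (fun R' h => hL R' (hsub h)) (fun R₁ h₁ R₂ h₂ => hlen R₁ (hsub h₁) R₂ (hsub h₂))
      (fun R' h => ?_) (fun R' h => (Finset.mem_filter.1 h).2.2.2)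
      (fun R' h => (Finset.mem_filter.1 h).2.2.1)
    obtain ⟨z, hz, hload⟩ := hgood R' (hsub h)
    exact ⟨z, hz, fun r hr =>
      (load_mono (Finset.filter_subset_filter _ hsub) z hr).trans (hload r hr)⟩
  calc ∑ R ∈ 𝓖, ∑ R' ∈ 𝓖 with e R < e R', volume (R.toSet ∩ R'.toSet)
      ≤ ∑ R ∈ 𝓖, ∑ R' ∈ 𝓖 with P R R', volume (R.toSet ∩ R'.toSet) +
          ∑ R ∈ 𝓖, ∑ R' ∈ 𝓖 with Q R R', volume (R.toSet ∩ R'.toSet) := by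
        rw [← Finset.sum_add_distrib]
        exact Finset.sum_le_sum hsplit
    _ ≤ ∑ R ∈ 𝓖, 21 * ENNReal.ofReal R.area +
          ∑ R ∈ 𝓖, 132 * ENNReal.ofReal δ⁻¹ * ENNReal.ofReal R.area := by
        refine add_le_add (le_trans (le_of_eq ?_) (Finset.sum_le_sum hcomp))
          (Finset.sum_le_sum htrans)
        simp_rw [Finset.sum_filter]
        exact Finset.sum_comm
    _ = _ := by rw [← Finset.mul_sum, ← Finset.mul_sum, add_mul]

open Classical in
theorem lintegral_sq_sum_indicator (𝓖 : Finset Pgram) {e : Pgram → ℕ} (hinj : Set.InjOn e 𝓖) :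
    ∫⁻ z, (∑ R ∈ 𝓖, R.toSet.indicator (fun _ => (1 : ℝ≥0∞)) z) ^ 2 =
      ∑ R ∈ 𝓖, ENNReal.ofReal R.area +
        2 * ∑ R ∈ 𝓖, ∑ R' ∈ 𝓖 with e R < e R', volume (R.toSet ∩ R'.toSet) := by
  have h1 : ∫⁻ z, (∑ R ∈ 𝓖, R.toSet.indicator (fun _ => (1 : ℝ≥0∞)) z) ^ 2 =
      ∑ R ∈ 𝓖, ∑ R' ∈ 𝓖, volume (R.toSet ∩ R'.toSet) := by
    have hm : ∀ R R' : Pgram, MeasurableSet (R.toSet ∩ R'.toSet) := fun R R' =>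
      R.measurableSet_toSet.inter R'.measurableSet_toSet
    simp_rw [pow_two, Finset.sum_mul_sum, ← Set.inter_indicator_mul, one_mul]
    rw [lintegral_finsetSum _ fun R _ =>
      Finset.measurable_sum _ fun R' _ => measurable_const.indicator (hm R R')]
    refine Finset.sum_congr rfl fun R _ => ?_
    rw [lintegral_finsetSum _ fun R' _ => measurable_const.indicator (hm R R')]
    refine Finset.sum_congr rfl fun R' _ => ?_
    rw [lintegral_indicator_const (hm R R'), one_mul]
  have h2 : ∑ R ∈ 𝓖, ∑ R' ∈ 𝓖 with e R' < e R, volume (R.toSet ∩ R'.toSet) =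
      ∑ R ∈ 𝓖, ∑ R' ∈ 𝓖 with e R < e R', volume (R.toSet ∩ R'.toSet) := by
    simp_rw [Finset.sum_filter]
    rw [Finset.sum_comm]
    simp_rw [Set.inter_comm]
  rw [h1, two_mul]
  nth_rewrite 1 [← h2]
  rw [← Finset.sum_add_distrib, ← Finset.sum_add_distrib]
  refine Finset.sum_congr rfl fun R hR => ?_
  have h3 : ENNReal.ofReal R.area =
      ∑ R' ∈ 𝓖, if R' = R then volume (R.toSet ∩ R'.toSet) else 0 := by
    rw [Finset.sum_ite_eq' 𝓖 R, if_pos hR, Set.inter_self, volume_toSet]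
  simp_rw [Finset.sum_filter]
  rw [h3, ← Finset.sum_add_distrib, ← Finset.sum_add_distrib]
  refine Finset.sum_congr rfl fun R' hR' => ?_
  rcases lt_trichotomy (e R) (e R') with h | h | h
  · have : R' ≠ R := by rintro rfl; exact h.false
    simp [this, h, h.not_gt]
  · simp [hinj hR hR' h]
  · have : R' ≠ R := by rintro rfl; exact h.false
    simp [this, h, h.not_gt]

end Pgram

/-- **Covering lemma for the Lipschitz–Kakeya maximal operator.** -/
theorem lipschitz_kakeya_covering :
    ∃ C : ℝ, 0 < C ∧
      ∀ (u : ℝ × ℝ → ℝ) (Lu : ℝ≥0), LipschitzWith Lu u →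
      ∀ δ : ℝ, 0 < δ → δ ≤ 1 →
      ∀ 𝓡 : Finset Pgram,
        (∀ R ∈ 𝓡, R.dyadicShadow) →
        (∀ R ∈ 𝓡, ENNReal.ofReal (δ * R.area) ≤ volume (Pgram.E u R)) →
        (∀ R ∈ 𝓡, R.len * (Lu : ℝ) ≤ 1 / 30) →
        ∃ 𝓖 ⊆ 𝓡,
          volume (⋃ R ∈ 𝓡, R.toSet)
              ≤ ENNReal.ofReal C * ENNReal.ofReal (∑ R ∈ 𝓖, R.area) ∧
          (∫⁻ z : ℝ × ℝ,
              (∑ R ∈ 𝓖, (R.toSet).indicator (fun _ => (1 : ℝ≥0∞)) z) ^ 2 ∂volume)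
            ≤ ENNReal.ofReal C * ENNReal.ofReal δ⁻¹
              * ENNReal.ofReal (∑ R ∈ 𝓖, R.area) := by
  classical
  refine ⟨307, by norm_num, fun u Lu hu δ hδ hδ1 𝓡 hdy hE hL => ?_⟩
  obtain ⟨𝓖, hsub, e, hinj, hlen, hgood, hbad⟩ := Pgram.exists_greedy_selection 𝓡
  have hsum : ∑ R ∈ 𝓖, ENNReal.ofReal R.area = ENNReal.ofReal (∑ R ∈ 𝓖, R.area) :=
    (ENNReal.ofReal_sum_of_nonneg fun R _ => R.area_pos.le).symm
  rw [show ENNReal.ofReal 307 = 307 by simp]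
  refine ⟨𝓖, hsub, ?_, ?_⟩
  · set A := ENNReal.ofReal (∑ R ∈ 𝓖, R.area)
    calc volume (⋃ R ∈ 𝓡, R.toSet)
        ≤ volume ((⋃ R ∈ 𝓖, R.toSet) ∪ ⋃ R ∈ 𝓡 \ 𝓖, R.toSet) := by
          rw [← Finset.set_biUnion_union, Finset.union_sdiff_of_subset hsub]
      _ ≤ A + 105 * A := by
          refine (measure_union_le _ _).trans (add_le_add ?_ ?_)
          · refine (measure_biUnion_finset_le _ _).trans (le_of_eq ?_)
            simp_rw [Pgram.volume_toSet, hsum]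
          · exact Pgram.volume_iUnion_le_of_load hbad
      _ = 106 * A := by ring
      _ ≤ 307 * A := by gcongr; norm_num
  · have hδ' : 1 ≤ ENNReal.ofReal δ⁻¹ :=
      ENNReal.one_le_ofReal.2 ((one_le_inv₀ hδ).2 hδ1)
    rw [Pgram.lintegral_sq_sum_indicator 𝓖 hinj]
    have hoff := Pgram.sum_volume_inter_of_lt_le hu hδ (fun R h => hdy R (hsub h)) hinj
      (fun R h => hE R (hsub h)) (fun R h => hL R (hsub h)) hlen hgood
    rw [hsum] at hoff ⊢
    set A := ENNReal.ofReal (∑ R ∈ 𝓖, R.area)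
    set D := ENNReal.ofReal δ⁻¹
    calc _ ≤ A + 2 * ((21 + 132 * D) * A) := by gcongr
      _ = (1 + 42 * 1 + 264 * D) * A := by ring
      _ ≤ (D + 42 * D + 264 * D) * A := by gcongr
      _ = 307 * D * A := by ring
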